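/- Assume k ≥ 2. Let U_2 = {u ∈ ℝ^n : u_i ≥ 0 for all i, u has at most k nonzero entries, and u_i ≤ 1 + (σ_k(u) − u_i)/(k−1) for every i ∈ Y}. Then U_2 is representative for L^(2): for every p in the simplex Δ there exists u ∈ U_2 such that Σ_{y∈Y} p_y L^(2)(u,y) ≤ Σ_{y∈Y} p_y L^(2)(u',y) for all u' ∈ ℝ^n. -/

import Mathlib

open scoped NNReal

def simplex (n : ℕ) : Set (Fin n → ℝ) := {p | (∀ i, 0 ≤ p i) ∧ ∑ i, p i = 1}

noncomputable def sigmaTop (n m : ℕ) (u : Fin n → ℝ) : ℝ :=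
  if h : ((Finset.univ : Finset (Fin n)).powersetCard m).Nonempty then
    ((Finset.univ : Finset (Fin n)).powersetCard m).sup' h (fun S => ∑ i ∈ S, u i)
  else 0

noncomputable def Lk (n k : ℕ) (u : Fin n → ℝ) (y : Fin n) : ℝ :=
  if h : (Finset.Icc 1 n).Nonempty then
    (Finset.Icc 1 n).sup' h
      (fun m => sigmaTop n m u / (m : ℝ) + max 0 (1 - (k : ℝ) / (m : ℝ))) - u y
  else 0

def indic {n : ℕ} (S : Finset (Fin n)) : Fin n → ℝ := fun i => if i ∈ S then 1 else 0

noncomputable def nthLarge {n : ℕ} (v : Fin n → ℝ) (j : ℕ) : ℝ :=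
  if h : n - j < n then v (Tuple.sort v ⟨n - j, h⟩) else 0

noncomputable def L2 (n k : ℕ) (u : Fin n → ℝ) (y : Fin n) : ℝ :=
  max 0 (1 - u y + (1 / (k : ℝ)) * sigmaTop n k (u - Pi.single y 1))

noncomputable def L3 (n k : ℕ) (u : Fin n → ℝ) (y : Fin n) : ℝ :=
  (1 / (k : ℝ)) * ∑ i ∈ Finset.Icc 1 k, max 0 (1 - u y + nthLarge (u - Pi.single y 1) i)

noncomputable def sigmaExcl (n k : ℕ) (u : Fin n → ℝ) (y : Fin n) : ℝ :=
  if h : ((Finset.univ.erase y).powersetCard k).Nonempty then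
    ((Finset.univ.erase y).powersetCard k).sup' h (fun S => ∑ i ∈ S, u i)
  else 0

noncomputable def L4 (n k : ℕ) (u : Fin n → ℝ) (y : Fin n) : ℝ :=
  max 0 (1 - u y + (1 / (k : ℝ)) * sigmaExcl n k u y)

noncomputable def ell2 (k : ℕ) {n : ℕ} (H M : Finset (Fin n)) (y : Fin n) : ℝ :=
  if y ∈ H then 0
  else if y ∈ M then ((H.card : ℝ) + M.card - 1) / ((k : ℝ) - H.card)
  else ((H.card : ℝ) + M.card - 1) / ((k : ℝ) - H.card) + ((k : ℝ) + 1) / k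

noncomputable def ell4 (k : ℕ) {n : ℕ} (T : Finset (Fin n)) (y : Fin n) : ℝ :=
  if y ∈ T then 0 else ((k : ℝ) + 1) / ((k : ℝ) + 1 - T.card)


section Reduction

variable {n k : ℕ}

theorem sum_le_sigmaTop {u : Fin n → ℝ} {R : Finset (Fin n)} (hR : R.card = k) :
    ∑ i ∈ R, u i ≤ sigmaTop n k u := by
  have hmem : R ∈ (Finset.univ : Finset (Fin n)).powersetCard k := by simp [hR]
  rw [sigmaTop, dif_pos ⟨R, hmem⟩]
  exact Finset.le_sup' (fun S => ∑ i ∈ S, u i) hmem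

theorem exists_sigmaTop_eq_sum (hkn : k < n) (u : Fin n → ℝ) :
    ∃ T : Finset (Fin n), T.card = k ∧ sigmaTop n k u = ∑ i ∈ T, u i := by
  have hne : ((Finset.univ : Finset (Fin n)).powersetCard k).Nonempty :=
    Finset.powersetCard_nonempty.2 (by simpa using hkn.le)
  obtain ⟨T, hT, h⟩ := Finset.exists_mem_eq_sup' hne (fun S => ∑ i ∈ S, u i)
  refine ⟨T, (Finset.mem_powersetCard.1 hT).2, ?_⟩
  rw [sigmaTop, dif_pos hne, h]

theorem sum_sub_single (u : Fin n → ℝ) (y : Fin n) (R : Finset (Fin n)) :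
    ∑ i ∈ R, (u - Pi.single y 1 : Fin n → ℝ) i = ∑ i ∈ R, u i - if y ∈ R then 1 else 0 := by
  simp [Finset.sum_sub_distrib]

theorem sum_insert_erase {u : Fin n → ℝ} {T : Finset (Fin n)} {i j : Fin n}
    (hi : i ∈ T) (hj : j ∉ T) :
    ∑ l ∈ insert j (T.erase i), u l = ∑ l ∈ T, u l - u i + u j := by
  rw [Finset.sum_insert (fun h => hj (Finset.mem_of_mem_erase h)), ← Finset.add_sum_erase T u hi]
  ring

theorem card_insert_erase {T : Finset (Fin n)} {i j : Fin n} (hi : i ∈ T) (hj : j ∉ T) :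
    (insert j (T.erase i)).card = T.card := by
  rw [Finset.card_insert_of_notMem (fun h => hj (Finset.mem_of_mem_erase h)),
    Finset.card_erase_add_one hi]

theorem exists_notMem_of_card (hkn : k < n) {T : Finset (Fin n)} (hT : T.card = k) :
    ∃ j, j ∉ T := by
  by_contra! h
  have : T = Finset.univ := Finset.eq_univ_iff_forall.2 h
  rw [this, Finset.card_univ, Fintype.card_fin] at hT
  omega

/-- The value of `L2` at a nonnegative vector with at most `k` nonzero entries. -/
noncomputable def sparseLoss (k : ℕ) (u : Fin n → ℝ) (y : Fin n) : ℝ :=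
  max 0 (1 - u y + (1 / (k : ℝ)) * (∑ i, u i - min 1 (u y)))

/-- Nonnegative vectors supported in `T`. -/
def nonnegOn (T : Finset (Fin n)) : Set (Fin n → ℝ) :=
  {u | (∀ i, 0 ≤ u i) ∧ ∀ i ∉ T, u i = 0}

theorem sum_eq_of_mem_nonnegOn {T : Finset (Fin n)} {u : Fin n → ℝ} (hu : u ∈ nonnegOn T) :
    ∑ i ∈ T, u i = ∑ i, u i :=
  Finset.sum_subset (Finset.subset_univ T) fun i _ hi => hu.2 i hi

theorem sigmaTop_eq_sum (hkn : k < n) {T : Finset (Fin n)} (hT : T.card = k)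
    {u : Fin n → ℝ} (hu : u ∈ nonnegOn T) : sigmaTop n k u = ∑ i, u i := by
  apply le_antisymm
  · obtain ⟨R, -, h⟩ := exists_sigmaTop_eq_sum hkn u
    rw [h]
    exact Finset.sum_le_sum_of_subset_of_nonneg (Finset.subset_univ R) fun i _ _ => hu.1 i
  · rw [← sum_eq_of_mem_nonnegOn hu]
    exact sum_le_sigmaTop hT

theorem sigmaTop_sub_single (hkn : k < n) {T : Finset (Fin n)} (hT : T.card = k)
    {u : Fin n → ℝ} (hu : u ∈ nonnegOn T) (y : Fin n) :
    sigmaTop n k (u - Pi.single y 1) = ∑ i, u i - min 1 (u y) := by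
  apply le_antisymm
  · obtain ⟨R, -, h⟩ := exists_sigmaTop_eq_sum hkn (u - Pi.single y 1)
    rw [h, sum_sub_single]
    split_ifs with hy
    · have := Finset.sum_le_sum_of_subset_of_nonneg (Finset.subset_univ R)
        fun i _ _ => hu.1 i
      linarith [min_le_left 1 (u y)]
    · have h1 : ∑ i ∈ R, u i ≤ ∑ i ∈ Finset.univ.erase y, u i :=
        Finset.sum_le_sum_of_subset_of_nonneg
          (fun i hi => Finset.mem_erase.2 ⟨fun h => hy (h ▸ hi), Finset.mem_univ i⟩)
          fun i _ _ => hu.1 i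
      have h2 := Finset.add_sum_erase Finset.univ u (Finset.mem_univ y)
      linarith [min_le_right 1 (u y)]
  · have h1 := sum_le_sigmaTop (u := u - Pi.single y 1) hT
    rw [sum_sub_single, sum_eq_of_mem_nonnegOn hu] at h1
    by_cases hy : y ∈ T
    · rw [if_pos hy] at h1
      obtain ⟨j, hj⟩ := exists_notMem_of_card hkn hT
      have h2 := sum_le_sigmaTop (u := u - Pi.single y 1) ((card_insert_erase hy hj).trans hT)
      have hyj : y ≠ j := fun h => hj (h ▸ hy)
      rw [sum_sub_single, if_neg (by simp [hyj]), sum_insert_erase hy hj, hu.2 j hj,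
        sum_eq_of_mem_nonnegOn hu] at h2
      rcases min_choice 1 (u y) with h | h <;> rw [h] <;> linarith
    · rw [if_neg hy] at h1
      rw [hu.2 y hy]
      norm_num at h1 ⊢
      exact h1

theorem L2_eq_sparseLoss (hkn : k < n) {T : Finset (Fin n)} (hT : T.card = k)
    {u : Fin n → ℝ} (hu : u ∈ nonnegOn T) (y : Fin n) : L2 n k u y = sparseLoss k u y := by
  rw [L2, sparseLoss, sigmaTop_sub_single hkn hT hu]

theorem le_L2 {R : Finset (Fin n)} (hR : R.card = k) (v : Fin n → ℝ) (y : Fin n) :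
    1 - v y + (1 / (k : ℝ)) * (∑ i ∈ R, v i - if y ∈ R then 1 else 0) ≤ L2 n k v y := by
  rw [L2, ← sum_sub_single]
  refine le_trans ?_ (le_max_right _ _)
  gcongr
  exact sum_le_sigmaTop hR

/-- Every vector is dominated by a nonnegative one with at most `k` nonzero entries. -/
theorem exists_nonnegOn_sparseLoss_le (hk : 0 < k) (hkn : k < n) (v : Fin n → ℝ) :
    ∃ T : Finset (Fin n), T.card = k ∧ ∃ u ∈ nonnegOn T,
      ∀ y, sparseLoss k u y ≤ L2 n k v y := by
  obtain ⟨T, hT, hmax⟩ := exists_sigmaTop_eq_sum hkn v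
  have hexch : ∀ i ∈ T, ∀ j ∉ T, v j ≤ v i := fun i hi j hj => by
    have h := sum_le_sigmaTop (u := v) ((card_insert_erase hi hj).trans hT)
    rw [sum_insert_erase hi hj, hmax] at h
    linarith
  obtain ⟨j, hj⟩ := exists_notMem_of_card hkn hT
  obtain ⟨j₀, hj₀, hj₀max⟩ := Finset.exists_max_image Tᶜ v ⟨j, Finset.mem_compl.2 hj⟩
  rw [Finset.mem_compl] at hj₀
  have hk' : (0 : ℝ) < k := by exact_mod_cast hk
  let u : Fin n → ℝ := fun i => if i ∈ T then v i - v j₀ else 0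
  have hu : u ∈ nonnegOn T := by
    refine ⟨fun i => ?_, fun i hi => if_neg hi⟩
    by_cases hi : i ∈ T
    · simpa [u, hi] using hexch i hi j₀ hj₀
    · simp [u, hi]
  have hsum : ∑ i, u i = ∑ i ∈ T, v i - k * v j₀ := by
    simp [u, Finset.sum_ite_mem, Finset.sum_sub_distrib, hT]
  refine ⟨T, hT, u, hu, fun y => max_le (le_max_left _ _) ?_⟩
  have h1 := le_L2 hT v y
  rw [hsum]
  by_cases hy : y ∈ T
  · have h2 := le_L2 ((card_insert_erase hy hj₀).trans hT) v y
    have hyj : y ≠ j₀ := fun h => hj₀ (h ▸ hy)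
    rw [if_neg (by simp [hyj]), sum_insert_erase hy hj₀] at h2
    rw [if_pos hy] at h1
    have huy : u y = v y - v j₀ := if_pos hy
    rcases min_choice 1 (u y) with h | h <;> rw [h, huy]
    · refine le_trans (le_of_eq ?_) h1
      field_simp
      ring
    · refine le_trans (le_of_eq ?_) h2
      field_simp
      ring
  · have huy : u y = 0 := if_neg hy
    rw [if_neg hy] at h1
    rw [huy, min_eq_right zero_le_one]
    have h3 := hj₀max y (Finset.mem_compl.2 hy)
    have h4 : 1 - 0 + (1 / (k : ℝ)) * (∑ i ∈ T, v i - k * v j₀ - 0)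
        = 1 - v j₀ + (1 / (k : ℝ)) * (∑ i ∈ T, v i - 0) := by
      field_simp
      ring
    linarith

theorem continuous_sparseLoss (y : Fin n) :
    Continuous fun u : Fin n → ℝ => sparseLoss k u y := by
  unfold sparseLoss
  fun_prop

theorem isClosed_nonnegOn (T : Finset (Fin n)) : IsClosed (nonnegOn T) := by
  have : nonnegOn T = (⋂ i, {u : Fin n → ℝ | 0 ≤ u i}) ∩ ⋂ i, ⋂ (_ : i ∉ T), {u | u i = 0} := by
    ext u
    simp [nonnegOn]
  rw [this]
  exact (isClosed_iInter fun i => isClosed_le continuous_const (continuous_apply i)).inter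
    (isClosed_iInter fun i => isClosed_iInter fun _ =>
      isClosed_eq (continuous_apply i) continuous_const)

theorem isCompact_nonnegOn_sum_le (T : Finset (Fin n)) (B : ℝ) :
    IsCompact (nonnegOn T ∩ {u | ∑ i, u i ≤ B}) := by
  refine (isCompact_Icc (a := (0 : Fin n → ℝ)) (b := fun _ => B)).of_isClosed_subset
    ((isClosed_nonnegOn T).inter (isClosed_le (by fun_prop) continuous_const)) ?_
  rintro u ⟨hu, hB⟩
  exact ⟨hu.1, fun i =>
    (Finset.single_le_sum (fun j _ => hu.1 j) (Finset.mem_univ i)).trans hB⟩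

/-- Lowering an entry that exceeds the bound `1 + (∑ - u i) / (k - 1)` to that bound
does not increase the loss. -/
theorem sparseLoss_update_le (hk : 2 ≤ k) {T : Finset (Fin n)} {u : Fin n → ℝ}
    (hu : u ∈ nonnegOn T) {i : Fin n} (hi : 1 + (∑ j, u j - u i) / ((k : ℝ) - 1) < u i) :
    ∃ w ∈ nonnegOn T, ∑ j, w j < ∑ j, u j ∧ ∀ y, sparseLoss k w y ≤ sparseLoss k u y := by
  have hk2 : (2 : ℝ) ≤ k := by exact_mod_cast hk
  have hsumi := Finset.add_sum_erase Finset.univ u (Finset.mem_univ i)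
  have hrest : 0 ≤ ∑ j ∈ Finset.univ.erase i, u j := Finset.sum_nonneg fun j _ => hu.1 j
  set c := 1 + (∑ j, u j - u i) / ((k : ℝ) - 1) with hc
  have hc1 : 1 ≤ c := by
    have : 0 ≤ (∑ j, u j - u i) / ((k : ℝ) - 1) := div_nonneg (by linarith) (by linarith)
    linarith
  have hsum : ∑ j, Function.update u i c j = c + (∑ j, u j - u i) := by
    rw [Finset.sum_update_of_mem (Finset.mem_univ i), ← Finset.erase_eq]
    linarith
  refine ⟨Function.update u i c, ⟨fun j => ?_, fun j hj => ?_⟩, by linarith, fun y => ?_⟩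
  · by_cases hji : j = i
    · subst hji
      simpa using (by linarith : (0 : ℝ) ≤ c)
    · simpa [hji] using hu.1 j
  · have hji : j ≠ i := by
      rintro rfl
      linarith [hu.2 j hj]
    simpa [hji] using hu.2 j hj
  · by_cases hy : y = i
    · subst hy
      refine max_le (le_max_left _ _) (le_trans (le_of_eq ?_) (le_max_left _ _))
      rw [hsum, Function.update_self, min_eq_left hc1, hc]
      have : (k : ℝ) - 1 ≠ 0 := by linarith
      field_simp
      ring
    · unfold sparseLoss
      rw [hsum, Function.update_of_ne hy]
      gcongr
      linarith

/-- If all entries on `T` exceed `1`, they can be lowered together without increasing the loss. -/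
theorem sparseLoss_sub_const_le (hk : 0 < k) {T : Finset (Fin n)} (hT : T.card = k)
    {u : Fin n → ℝ} (hu : u ∈ nonnegOn T) (h : ∀ i ∈ T, 1 < u i) :
    ∃ w ∈ nonnegOn T, ∑ j, w j < ∑ j, u j ∧ ∀ y, sparseLoss k w y ≤ sparseLoss k u y := by
  have hk' : (0 : ℝ) < k := by exact_mod_cast hk
  obtain ⟨m, hm, hmin⟩ := Finset.exists_min_image T u (Finset.card_pos.1 (hT ▸ hk))
  have hm1 := h m hm
  let w : Fin n → ℝ := fun i => if i ∈ T then u i - (u m - 1) else 0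
  have hsum : ∑ i, w i = ∑ i, u i - k * (u m - 1) := by
    rw [← sum_eq_of_mem_nonnegOn hu]
    simp [w, Finset.sum_ite_mem, Finset.sum_sub_distrib, hT]
    ring
  have hpos : 0 < k * (u m - 1) := mul_pos hk' (by linarith)
  refine ⟨w, ⟨fun i => ?_, fun i hi => if_neg hi⟩, by linarith, fun y => ?_⟩
  · by_cases hi : i ∈ T
    · have := hmin i hi
      simp only [w, if_pos hi]
      linarith
    · simp [w, hi]
  · unfold sparseLoss
    rw [hsum]
    by_cases hy : y ∈ T
    · have hwy : w y = u y - (u m - 1) := if_pos hy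
      have := hmin y hy
      rw [hwy, min_eq_left (by linarith), min_eq_left (h y hy).le]
      refine max_le_max le_rfl (le_of_eq ?_)
      field_simp
      ring
    · have hwy : w y = u y := (if_neg hy).trans (hu.2 y hy).symm
      rw [hwy]
      gcongr
      linarith

/-- Every nonnegative vector supported in `T` is dominated by one satisfying the entrywise bound,
whose sum is bounded in terms of `k`. -/
theorem exists_bounded_sparseLoss_le (hk : 2 ≤ k) {T : Finset (Fin n)} (hT : T.card = k)
    {u : Fin n → ℝ} (hu : u ∈ nonnegOn T) :
    ∃ w ∈ nonnegOn T, (∀ i, w i ≤ 1 + (∑ j, w j - w i) / ((k : ℝ) - 1)) ∧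
      ∑ j, w j ≤ (k : ℝ) + ((k : ℝ) - 1) ^ 2 ∧ ∀ y, sparseLoss k w y ≤ sparseLoss k u y := by
  have hk2 : (2 : ℝ) ≤ k := by exact_mod_cast hk
  have hcpt : IsCompact ((nonnegOn T ∩ {w | ∑ i, w i ≤ ∑ i, u i}) ∩
      ⋂ y, {w | sparseLoss k w y ≤ sparseLoss k u y}) :=
    (isCompact_nonnegOn_sum_le T _).inter_right
      (isClosed_iInter fun y => isClosed_le (continuous_sparseLoss y) continuous_const)
  obtain ⟨w, ⟨⟨hw, hwsum⟩, hwloss⟩, hmin⟩ := hcpt.exists_isMinOn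
    ⟨u, ⟨hu, le_refl (∑ i, u i)⟩, Set.mem_iInter.2 fun y => le_refl (sparseLoss k u y)⟩
    (f := fun w : Fin n → ℝ => ∑ i, w i) (by fun_prop)
  have hwloss' : ∀ y, sparseLoss k w y ≤ sparseLoss k u y := Set.mem_iInter.1 hwloss
  have hno : ¬ ∃ w' ∈ nonnegOn T, ∑ j, w' j < ∑ j, w j ∧
      ∀ y, sparseLoss k w' y ≤ sparseLoss k w y := by
    rintro ⟨w', hw', hlt, hle⟩
    exact hlt.not_ge (isMinOn_iff.1 hmin w' ⟨⟨hw', hlt.le.trans hwsum⟩,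
      Set.mem_iInter.2 fun y => (hle y).trans (hwloss' y)⟩)
  have hbd : ∀ i, w i ≤ 1 + (∑ j, w j - w i) / ((k : ℝ) - 1) := fun i => by
    by_contra! hi
    exact hno (sparseLoss_update_le hk hw hi)
  refine ⟨w, hw, hbd, ?_, hwloss'⟩
  obtain ⟨m, hm, hm1⟩ : ∃ m ∈ T, w m ≤ 1 := by
    by_contra! h
    exact hno (sparseLoss_sub_const_le (by omega) hT hw h)
  have hle : ∀ i ∈ T.erase m, w i ≤ ((k : ℝ) - 1 + ∑ j, w j) / k := fun i _ => by
    have h1 : (0 : ℝ) < k - 1 := by linarith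
    have h2 := hbd i
    rw [← sub_le_iff_le_add', le_div_iff₀ h1] at h2
    rw [le_div_iff₀ (by linarith)]
    linarith
  have hsum := Finset.sum_le_card_nsmul _ _ _ hle
  rw [Finset.card_erase_of_mem hm, hT, nsmul_eq_mul, Nat.cast_sub (by omega), Nat.cast_one,
    mul_div_assoc', le_div_iff₀ (by linarith)] at hsum
  have hadd := Finset.add_sum_erase T w hm
  rw [sum_eq_of_mem_nonnegOn hw] at hadd
  nlinarith

end Reduction

theorem stmt9 (n k : ℕ) (hk : 2 ≤ k) (hkn : k < n) :
    ∀ p ∈ simplex n, ∃ u : Fin n → ℝ,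
      ((∀ i, 0 ≤ u i) ∧ (∃ T : Finset (Fin n), T.card ≤ k ∧ ∀ i ∉ T, u i = 0) ∧
        ∀ i, u i ≤ 1 + (sigmaTop n k u - u i) / ((k : ℝ) - 1)) ∧
      ∀ v : Fin n → ℝ, ∑ y, p y * L2 n k u y ≤ ∑ y, p y * L2 n k v y := by
  intro p hp
  let K : Set (Fin n → ℝ) := ⋃ T ∈ (Finset.univ : Finset (Fin n)).powersetCard k,
    nonnegOn T ∩ {u | ∑ i, u i ≤ (k : ℝ) + ((k : ℝ) - 1) ^ 2}
  have hmemK : ∀ {T : Finset (Fin n)} {u : Fin n → ℝ}, T.card = k → u ∈ nonnegOn T →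
      ∑ i, u i ≤ (k : ℝ) + ((k : ℝ) - 1) ^ 2 → u ∈ K := fun {T u} hT hu hs =>
    Set.mem_iUnion₂.2 ⟨T, by simp [hT], hu, hs⟩
  have hdom : ∀ {u v : Fin n → ℝ}, (∀ y, sparseLoss k u y ≤ L2 n k v y) →
      ∑ y, p y * sparseLoss k u y ≤ ∑ y, p y * L2 n k v y := fun h =>
    Finset.sum_le_sum fun y _ => mul_le_mul_of_nonneg_left (h y) (hp.1 y)
  have hred : ∀ v : Fin n → ℝ, ∃ u ∈ K, ∀ y, sparseLoss k u y ≤ L2 n k v y := fun v => by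
    obtain ⟨T, hT, u, hu, h⟩ := exists_nonnegOn_sparseLoss_le (by omega) hkn v
    obtain ⟨w, hw, -, hs, h'⟩ := exists_bounded_sparseLoss_le hk hT hu
    exact ⟨w, hmemK hT hw hs, fun y => (h' y).trans (h y)⟩
  have hK : IsCompact K := Finset.isCompact_biUnion _ fun T _ => isCompact_nonnegOn_sum_le T _
  obtain ⟨u₀, hu₀, hmin⟩ := hK.exists_isMinOn ((hred 0).imp fun _ h => h.1)
    (f := fun u => ∑ y, p y * sparseLoss k u y)
    (continuous_finsetSum _ fun y _ =>
      continuous_const.mul (continuous_sparseLoss y)).continuousOn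
  obtain ⟨T, hTmem, hu₀T, -⟩ := Set.mem_iUnion₂.1 hu₀
  have hT : T.card = k := (Finset.mem_powersetCard.1 hTmem).2
  obtain ⟨w, hw, hbd, -, hle⟩ := exists_bounded_sparseLoss_le hk hT hu₀T
  refine ⟨w, ⟨hw.1, ⟨T, hT.le, hw.2⟩, ?_⟩, fun v => ?_⟩
  · rwa [sigmaTop_eq_sum hkn hT hw]
  · obtain ⟨u, hu, huv⟩ := hred v
    calc ∑ y, p y * L2 n k w y = ∑ y, p y * sparseLoss k w y := by
          simp_rw [L2_eq_sparseLoss hkn hT hw]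
      _ ≤ ∑ y, p y * sparseLoss k u₀ y :=
          Finset.sum_le_sum fun y _ => mul_le_mul_of_nonneg_left (hle y) (hp.1 y)
      _ ≤ ∑ y, p y * sparseLoss k u y := isMinOn_iff.1 hmin u hu
      _ ≤ ∑ y, p y * L2 n k v y := hdom huv
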